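/- arXiv:1508.06802 — 3 statements merged into one kernel-verified Lean document; each statement's English description precedes it below -/
import Mathlib

section
/- Let n ≥ 1 and let x, y ∈ {0,1}^n with x ≠ y. Then |{z ∈ {0,1}^n : dist(x, z) < dist(y, z)}| = |{z ∈ {0,1}^n : dist(x, z) > dist(y, z)}|, and |{z ∈ {0,1}^n : dist(x, z) = dist(y, z)}| ≤ 2^{n−1}. -/
lemma hd_split {n : ℕ} (a b : Fin n → Bool) (i : Fin n) :
    hammingDist a b = (if a i ≠ b i then 1 else 0) +
      ∑ j ∈ Finset.univ.erase i, (if a j ≠ b j then 1 else 0) := by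
  rw [hammingDist, Finset.card_filter,
    ← Finset.add_sum_erase Finset.univ _ (Finset.mem_univ i)]

lemma hd_upd {n : ℕ} (a b : Fin n → Bool) (i : Fin n) :
    hammingDist a (Function.update b i (!b i)) + (if a i ≠ b i then 1 else 0) =
      hammingDist a b + (if a i = b i then 1 else 0) := by
  rw [hd_split a b i, hd_split a (Function.update b i (!b i)) i]
  have h : ∑ j ∈ Finset.univ.erase i,
      (if a j ≠ (Function.update b i (!b i)) j then 1 else 0)
      = ∑ j ∈ Finset.univ.erase i, (if a j ≠ b j then 1 else 0) := by
    apply Finset.sum_congr rfl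
    intro j hj
    rw [Function.update_of_ne (Finset.ne_of_mem_erase hj)]
  rw [h, Function.update_self]
  cases a i <;> cases b i <;> simp <;> omega

lemma hd_xor {n : ℕ} (x y z : Fin n → Bool) :
    hammingDist x (fun j => xor (z j) (xor (x j) (y j))) = hammingDist y z := by
  unfold hammingDist
  congr 1
  ext j
  simp only [Finset.mem_filter, Finset.mem_univ, true_and]
  cases x j <;> cases y j <;> cases z j <;> decide

lemma hd_xor' {n : ℕ} (x y z : Fin n → Bool) :
    hammingDist y (fun j => xor (z j) (xor (x j) (y j))) = hammingDist x z := by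
  unfold hammingDist
  congr 1
  ext j
  simp only [Finset.mem_filter, Finset.mem_univ, true_and]
  cases x j <;> cases y j <;> cases z j <;> decide

/-- For distinct `x, y ∈ {0,1}^n`, the targets `z` closer to `x` than to `y` are in
bijection with those closer to `y` than to `x`, and at most `2^(n-1)` targets are
equidistant from `x` and `y`. -/
theorem onemax_target_split
    (n : ℕ) (hn : 1 ≤ n) (x y : Fin n → Bool) (hxy : x ≠ y) :
    (Finset.univ.filter fun z : Fin n → Bool =>
        hammingDist x z < hammingDist y z).card
      = (Finset.univ.filter fun z : Fin n → Bool =>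
        hammingDist y z < hammingDist x z).card ∧
    (Finset.univ.filter fun z : Fin n → Bool =>
        hammingDist x z = hammingDist y z).card ≤ 2 ^ (n - 1) := by
  constructor
  · refine Finset.card_nbij' (fun z j => xor (z j) (xor (x j) (y j)))
      (fun z j => xor (z j) (xor (x j) (y j))) ?_ ?_ ?_ ?_
    · intro z hz
      simpa [hd_xor, hd_xor'] using hz
    · intro z hz
      simpa [hd_xor, hd_xor'] using hz
    · intro z _
      funext j
      simp
    · intro z _
      funext j
      simp
  · obtain ⟨i, hi⟩ := Function.ne_iff.mp hxy
    set E := Finset.univ.filter fun z : Fin n → Bool =>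
        hammingDist x z = hammingDist y z with hE
    have hle : E.card ≤ Eᶜ.card := by
      refine Finset.card_le_card_of_injOn
        (fun z => Function.update z i (!z i)) ?_ ?_
      · intro z hz
        have hz' : hammingDist x z = hammingDist y z := by simpa [hE] using hz
        have h1 := hd_upd x z i
        have h2 := hd_upd y z i
        have : hammingDist x (Function.update z i (!z i)) ≠
            hammingDist y (Function.update z i (!z i)) := by
          intro h
          rw [h, hz'] at h1
          generalize hammingDist y (Function.update z i (!z i)) = p at h1 h2
          revert h1 h2 hi
          cases x i <;> cases y i <;> cases z i <;> simp <;> omega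
        simpa [hE] using this
      · intro z _ w _ h
        funext j
        have hj := congrFun h j
        by_cases hji : j = i
        · subst hji
          simpa using hj
        · simpa [Function.update_of_ne hji] using hj
    have hc := Finset.card_add_card_compl E
    rw [Fintype.card_fun, Fintype.card_bool, Fintype.card_fin] at hc
    obtain ⟨m, rfl⟩ : ∃ m, n = m + 1 := ⟨n - 1, by omega⟩
    rw [pow_succ] at hc
    simp only [Nat.add_sub_cancel]
    omega
end

section
/- Let n ≥ 1, let z1, z2 ∈ {0,1}^n with z1 ≠ z2, and let f = Om_{z1,z2}. Then for every x ∈ {0,1}^n with x ∉ {z1, z2}, the number of coordinates j ∈ {1,…,n} such that flipping the j-th bit of x strictly increases the fitness, i.e., f(x with bit j flipped) > f(x), is at least n − f(x). -/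
/-- The double OneMax function `Om_{z1,z2}`: fitness `n+1` at `z1`, and
`max (n - dist(x,z1)) (n - dist(x,z2))` elsewhere. -/
def doubleOneMax (n : ℕ) (z1 z2 : Fin n → Bool) (x : Fin n → Bool) : ℕ :=
  if x = z1 then n + 1 else max (n - hammingDist x z1) (n - hammingDist x z2)

theorem hd_flip {n : ℕ} (x z : Fin n → Bool) (j : Fin n) (h : x j ≠ z j) :
    hammingDist (Function.update x j (!x j)) z + 1 = hammingDist x z := by
  unfold hammingDist
  have : (Finset.univ.filter fun i => Function.update x j (!x j) i ≠ z i)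
      = (Finset.univ.filter fun i => x i ≠ z i).erase j := by
    ext i
    by_cases hi : i = j
    · subst hi
      simp
      revert h
      cases x i <;> cases z i <;> simp
    · simp [hi]
  rw [this]
  exact Finset.card_erase_add_one (by simp [h])

theorem progress_aux (n : ℕ) (z1 z2 x z : Fin n → Bool) (hx1 : x ≠ z1)
    (hz : z = z1 ∨ z = z2)
    (hf : doubleOneMax n z1 z2 x = n - hammingDist x z) :
    n - doubleOneMax n z1 z2 x ≤
      (Finset.univ.filter fun j : Fin n =>
        doubleOneMax n z1 z2 x <
          doubleOneMax n z1 z2 (Function.update x j (!x j))).card := by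
  have hle : hammingDist x z ≤ n := by simpa using hammingDist_le_card_fintype (x := x) (y := z)
  have h1 : n - doubleOneMax n z1 z2 x = hammingDist x z := by omega
  rw [h1]
  unfold hammingDist
  apply Finset.card_le_card
  intro j hj
  simp only [Finset.mem_filter, Finset.mem_univ, true_and] at hj ⊢
  have h2 := hd_flip x z j hj
  rw [hf]
  unfold doubleOneMax
  split_ifs
  · omega
  · rcases hz with rfl | rfl
    · exact lt_max_of_lt_left (by omega)
    · exact lt_max_of_lt_right (by omega)

/-- Progress lemma from the proof of Theorem 2: whenever the current search point `x` is
not one of the two peaks, at least `n - f(x)` of the `n` one-bit flips strictly increase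
the double OneMax fitness `f = Om_{z1,z2}`. -/
theorem doubleOneMax_progress
    (n : ℕ) (hn : 1 ≤ n) (z1 z2 : Fin n → Bool) (hz : z1 ≠ z2)
    (x : Fin n → Bool) (hx1 : x ≠ z1) (hx2 : x ≠ z2) :
    n - doubleOneMax n z1 z2 x ≤
      (Finset.univ.filter fun j : Fin n =>
        doubleOneMax n z1 z2 x <
          doubleOneMax n z1 z2 (Function.update x j (!x j))).card := by
  rcases max_choice (n - hammingDist x z1) (n - hammingDist x z2) with h | h
  · exact progress_aux n z1 z2 x z1 hx1 (Or.inl rfl) (by rw [doubleOneMax, if_neg hx1, h])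
  · exact progress_aux n z1 z2 x z2 hx1 (Or.inr rfl) (by rw [doubleOneMax, if_neg hx1, h])
end

section
/- Let k ≥ 1 and n = 2^k. Then there exists a partition of {0,1}^n into 2^n / n pairwise disjoint sets whose union is all of {0,1}^n, such that each set has cardinality exactly n and any two distinct elements of the same set have Hamming distance exactly n/2. -/
def HadB (z : ZMod 2) : Bool := decide (z = 1)

lemma HadB_add (z w : ZMod 2) : HadB (z + w) = xor (HadB z) (HadB w) := by
  revert z w; decide

lemma HadB_ne (z w : ZMod 2) : HadB z ≠ HadB w ↔ z - w = 1 := by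
  revert z w; decide

lemma had_flip (z : ZMod 2) : z + 1 = 1 ↔ ¬ z = 1 := by
  revert z; decide

lemma had_one (z : ZMod 2) (h : z ≠ 0) : z = 1 := by
  revert z; decide

lemma had_half (k : ℕ) (d : Fin k → ZMod 2) (hd : d ≠ 0) :
    2 * (Finset.univ.filter (fun v : Fin k → ZMod 2 => d ⬝ᵥ v = 1)).card = 2 ^ k := by
  obtain ⟨j, hj⟩ := Function.ne_iff.mp hd
  have hj1 : d j = 1 := had_one _ hj
  have h1 : (Finset.univ.filter (fun v : Fin k → ZMod 2 => d ⬝ᵥ v = 1)).card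
      = (Finset.univ.filter (fun v : Fin k → ZMod 2 => ¬ d ⬝ᵥ v = 1)).card := by
    refine Finset.card_equiv (Equiv.addRight (Pi.single j 1)) ?_
    intro v
    simp only [Finset.mem_filter, Finset.mem_univ, true_and, Equiv.coe_addRight,
      dotProduct_add, dotProduct_single, hj1, mul_one, had_flip, not_not]
  have h2 := Finset.card_filter_add_card_filter_not
    (s := (Finset.univ : Finset (Fin k → ZMod 2))) (fun v => d ⬝ᵥ v = 1)
  have h3 : (Finset.univ : Finset (Fin k → ZMod 2)).card = 2 ^ k := by simp [ZMod.card]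
  omega

/-- Hadamard-code partition used in the lower bound of Theorem 4: for `n = 2^k` the
hypercube `{0,1}^n` can be partitioned into `2^n / n` sets of size `n` each, such that
any two distinct elements of the same set have Hamming distance exactly `n/2`. -/
theorem hadamard_partition
    (k n : ℕ) (hk : 1 ≤ k) (hn : n = 2 ^ k) :
    ∃ P : Finset (Finset (Fin n → Bool)),
      P.card = 2 ^ n / n ∧
      (∀ S ∈ P, ∀ T ∈ P, S ≠ T → Disjoint S T) ∧
      P.biUnion id = Finset.univ ∧
      (∀ S ∈ P, S.card = n) ∧
      (∀ S ∈ P, ∀ x ∈ S, ∀ y ∈ S, x ≠ y → hammingDist x y = n / 2) := by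
  have hcard : Fintype.card (Fin n) = Fintype.card (Fin k → ZMod 2) := by simp [ZMod.card, hn]
  let e : Fin n ≃ (Fin k → ZMod 2) := Fintype.equivOfCardEq hcard
  let w : (Fin n → Bool) → (Fin k → ZMod 2) → (Fin n → Bool) :=
    fun x a i => xor (x i) (HadB (a ⬝ᵥ e i))
  have hn2 : 0 < n / 2 := by
    obtain ⟨m, rfl⟩ := Nat.exists_eq_add_of_le hk
    have : 0 < 2 ^ m := by positivity
    rw [hn, pow_add]; omega
  have hdist : ∀ x a b, a ≠ b → hammingDist (w x a) (w x b) = n / 2 := by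
    intro x a b hab
    have h := had_half k (a - b) (sub_ne_zero.mpr hab)
    have h1 : hammingDist (w x a) (w x b)
        = (Finset.univ.filter (fun v : Fin k → ZMod 2 => (a - b) ⬝ᵥ v = 1)).card := by
      unfold hammingDist
      refine Finset.card_equiv e ?_
      intro i
      simp only [Finset.mem_filter, Finset.mem_univ, true_and, w, sub_dotProduct]
      rw [← HadB_ne]
      simp
    omega
  have hinj : ∀ x, Function.Injective (w x) := by
    intro x a b hab
    by_contra hne
    have := hdist x a b hne
    rw [hab, hammingDist_self] at this
    omega
  have hadd : ∀ x a b, w (w x a) b = w x (a + b) := by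
    intro x a b
    funext i
    simp only [w, add_dotProduct, HadB_add, Bool.xor_assoc]
  have hzero : ∀ x, w x 0 = x := by
    intro x
    funext i
    simp [w, HadB]
  let cell : (Fin n → Bool) → Finset (Fin n → Bool) := fun x => Finset.univ.image (w x)
  have hmem : ∀ x y, y ∈ cell x ↔ ∃ a, w x a = y := by
    intro x y; simp [cell]
  have hcell : ∀ x y, y ∈ cell x → cell y = cell x := by
    intro x y hy
    obtain ⟨a, rfl⟩ := (hmem _ _).1 hy
    ext z
    rw [hmem, hmem]
    constructor
    · rintro ⟨b, rfl⟩
      exact ⟨a + b, (hadd _ _ _).symm⟩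
    · rintro ⟨b, rfl⟩
      exact ⟨b - a, by rw [hadd]; congr 1; abel⟩
  have hcc : ∀ x, (cell x).card = n := by
    intro x
    simp only [cell]
    rw [Finset.card_image_of_injective _ (hinj x), Finset.card_univ, ← hcard, Fintype.card_fin]
  have hdisj : ∀ S ∈ Finset.univ.image cell, ∀ T ∈ Finset.univ.image cell,
      S ≠ T → Disjoint S T := by
    intro S hS T hT hST
    obtain ⟨x, -, rfl⟩ := Finset.mem_image.1 hS
    obtain ⟨y, -, rfl⟩ := Finset.mem_image.1 hT
    rw [Finset.disjoint_left]
    intro z hz hz'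
    exact hST ((hcell _ _ hz).symm.trans (hcell _ _ hz'))
  have hun : (Finset.univ.image cell).biUnion id = Finset.univ := by
    ext x
    simp only [Finset.mem_biUnion, Finset.mem_univ, iff_true, id]
    exact ⟨cell x, Finset.mem_image_of_mem _ (Finset.mem_univ _), (hmem _ _).2 ⟨0, hzero x⟩⟩
  have hsz : ∀ S ∈ Finset.univ.image cell, S.card = n := by
    intro S hS
    obtain ⟨x, -, rfl⟩ := Finset.mem_image.1 hS
    exact hcc x
  refine ⟨Finset.univ.image cell, ?_, hdisj, hun, hsz, ?_⟩
  · have h1 := Finset.card_biUnion (s := Finset.univ.image cell) (t := id) hdisj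
    rw [hun, Finset.sum_congr rfl (f := fun u => (id u).card) (g := fun _ => n) (fun S hS => hsz S hS), Finset.sum_const,
      smul_eq_mul, Finset.card_univ, Fintype.card_fun, Fintype.card_bool, Fintype.card_fin] at h1
    rw [h1, Nat.mul_div_cancel _ (by omega)]
  · intro S hS x hx y hy hxy
    obtain ⟨z, -, rfl⟩ := Finset.mem_image.1 hS
    obtain ⟨a, rfl⟩ := (hmem _ _).1 hx
    obtain ⟨b, rfl⟩ := (hmem _ _).1 hy
    exact hdist z a b (fun h => hxy (by rw [h]))
end
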